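/- Let 0 < ρ_A < 1, 0 < ρ_B < 1, 0 < ε < 1/2 and 1/2 + ε < γ < 1. For each Δ, let C_A ⊆ F₂^Δ be the row space of a uniformly random ⌊ρ_A Δ⌋×Δ matrix over F₂ and let C_B ⊆ F₂^Δ be the kernel of an independent uniformly random ⌊(1−ρ_B)Δ⌋×Δ matrix over F₂. Then the probability that the dual tensor code C_A ⊗ F₂^B + F₂^A ⊗ C_B is Δ^{3/2−ε}-robust with Δ^γ-resistance to puncturing tends to 1 as Δ → ∞. -/

import Mathlib

noncomputable section

/-- Hamming weight of a binary word. -/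
def wt {ι : Type*} (x : ι → ZMod 2) : ℕ := {i | x i ≠ 0}.ncard

/-- Hamming distance from a word to a set of words. -/
def distTo {ι : Type*} (x : ι → ZMod 2) (S : Set (ι → ZMod 2)) : ℕ :=
  sInf {d : ℕ | ∃ c ∈ S, wt (x - c) = d}

/-- Minimum distance of a linear code. -/
def minDist {ι : Type*} (C : Submodule (ZMod 2) (ι → ZMod 2)) : ℕ :=
  sInf {d : ℕ | ∃ c ∈ C, c ≠ 0 ∧ wt c = d}

/-- Dual code with respect to the standard bilinear form. -/
def dualCode {ι : Type*} [Finite ι] (C : Submodule (ZMod 2) (ι → ZMod 2)) :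
    Submodule (ZMod 2) (ι → ZMod 2) :=
  letI := Fintype.ofFinite ι
  { carrier := {x | ∀ c ∈ C, ∑ i, x i * c i = 0}
    add_mem' := by
      intro x y hx hy c hc
      have h : ∑ i, (x + y) i * c i = (∑ i, x i * c i) + ∑ i, y i * c i := by
        simp [add_mul, Finset.sum_add_distrib]
      simp only [Set.mem_setOf_eq] at *
      rw [h, hx c hc, hy c hc, add_zero]
    zero_mem' := by
      simp
    smul_mem' := by
      intro t x hx c hc
      have h : ∑ i, (t • x) i * c i = t * ∑ i, x i * c i := by
        simp [Finset.mul_sum, mul_assoc]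
      simp only [Set.mem_setOf_eq] at *
      rw [h, hx c hc, mul_zero] }

/-- The code of matrices all of whose columns lie in `CA`. -/
def colCode {A : Type*} (B : Type*) (CA : Submodule (ZMod 2) (A → ZMod 2)) :
    Submodule (ZMod 2) (A × B → ZMod 2) where
  carrier := {x | ∀ b : B, (fun a => x (a, b)) ∈ CA}
  add_mem' := by intro x y hx hy b; exact CA.add_mem (hx b) (hy b)
  zero_mem' := by intro b; exact CA.zero_mem
  smul_mem' := by intro t x hx b; exact CA.smul_mem t (hx b)

/-- The code of matrices all of whose rows lie in `CB`. -/
def rowCode (A : Type*) {B : Type*} (CB : Submodule (ZMod 2) (B → ZMod 2)) :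
    Submodule (ZMod 2) (A × B → ZMod 2) where
  carrier := {x | ∀ a : A, (fun b => x (a, b)) ∈ CB}
  add_mem' := by intro x y hx hy a; exact CB.add_mem (hx a) (hy a)
  zero_mem' := by intro a; exact CB.zero_mem
  smul_mem' := by intro t x hx a; exact CB.smul_mem t (hx a)

/-- Tensor code `C_A ⊗ C_B`. -/
def tensorCode {A B : Type*} (CA : Submodule (ZMod 2) (A → ZMod 2))
    (CB : Submodule (ZMod 2) (B → ZMod 2)) : Submodule (ZMod 2) (A × B → ZMod 2) :=
  colCode B CA ⊓ rowCode A CB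

/-- Dual tensor code `C_A ⊗ F₂^B + F₂^A ⊗ C_B`. -/
def dualTensor {A B : Type*} (CA : Submodule (ZMod 2) (A → ZMod 2))
    (CB : Submodule (ZMod 2) (B → ZMod 2)) : Submodule (ZMod 2) (A × B → ZMod 2) :=
  colCode B CA ⊔ rowCode A CB

/-- `w`-robustness of the dual tensor code of `CA` and `CB`. -/
def IsRobust {A B : Type*} (CA : Submodule (ZMod 2) (A → ZMod 2))
    (CB : Submodule (ZMod 2) (B → ZMod 2)) (w : ℝ) : Prop :=
  ∀ c ∈ dualTensor CA CB, (wt c : ℝ) ≤ w →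
    ∃ (A' : Set A) (B' : Set B),
      (A'.ncard : ℝ) ≤ (wt c : ℝ) / (minDist CB : ℝ) ∧
      (B'.ncard : ℝ) ≤ (wt c : ℝ) / (minDist CA : ℝ) ∧
      ∀ a b, a ∉ A' → b ∉ B' → c (a, b) = 0

/-- Punctured code: restrictions of codewords of `C` to the coordinates in `A'`. -/
def punct {A : Type*} (C : Submodule (ZMod 2) (A → ZMod 2)) (A' : Set A) :
    Submodule (ZMod 2) (↥A' → ZMod 2) :=
  C.map (LinearMap.funLeft (ZMod 2) (ZMod 2) ((↑) : ↥A' → A))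

/-- `w`-robustness with `p`-resistance to puncturing. -/
def IsRobustPunct {A B : Type*} [Finite A] [Finite B]
    (CA : Submodule (ZMod 2) (A → ZMod 2)) (CB : Submodule (ZMod 2) (B → ZMod 2))
    (w p : ℝ) : Prop :=
  ∀ (A' : Set A) (B' : Set B) (w' : ℕ), (w' : ℝ) ≤ p →
    A'.ncard + w' = Nat.card A → B'.ncard + w' = Nat.card B →
    IsRobust (punct CA A') (punct CB B') w

section Complex

variable {G : Type*} [Group G] [DecidableEq G]

/-- Total no-conjugacy condition. -/
def TNC (A B : Set G) : Prop := ∀ g : G, ∀ a ∈ A, ∀ b ∈ B, a * g ≠ g * b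

/-- The square associated to `(g, a, b)`. -/
def cpxSq (g a b : G) : Finset (G × Bool) :=
  {(g, false), (a * g, true), (g * b, true), (a * g * b, false)}

/-- The set `Q` of squares of the left-right Cayley complex. -/
def Squares (A B : Set G) : Set (Finset (G × Bool)) :=
  {q | ∃ g : G, ∃ a ∈ A, ∃ b ∈ B, q = cpxSq g a b}

/-- Local view of `x : F₂^Q` at the vertex `(g, 0) ∈ V₀`, as an element of `F₂^{A×B}`. -/
def lview0 (A B : Set G) (x : ↥(Squares A B) → ZMod 2) (g : G) :
    ↥A × ↥B → ZMod 2 :=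
  fun ab => x ⟨cpxSq g (ab.1 : G) (ab.2 : G), ⟨g, (ab.1 : G), ab.1.2, (ab.2 : G), ab.2.2, rfl⟩⟩

/-- Local view of `x : F₂^Q` at the vertex `(g, 1) ∈ V₁`, as an element of `F₂^{A×B}`. -/
def lview1 {A B : Set G} (hA : ∀ a ∈ A, a⁻¹ ∈ A) (x : ↥(Squares A B) → ZMod 2) (g : G) :
    ↥A × ↥B → ZMod 2 :=
  fun ab => x ⟨cpxSq ((ab.1 : G) * g) (ab.1 : G)⁻¹ (ab.2 : G),
    ⟨(ab.1 : G) * g, (ab.1 : G)⁻¹, hA _ ab.1.2, (ab.2 : G), ab.2.2, rfl⟩⟩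

/-- The classical code 𝒞₀ of the quantum Tanner code: all local views at
vertices of `V₀` lie in `C₀^⊥ = (C_A ⊗ C_B)^⊥`. -/
def qC0 [Finite G] (A B : Set G) (CA : Submodule (ZMod 2) (↥A → ZMod 2))
    (CB : Submodule (ZMod 2) (↥B → ZMod 2)) :
    Submodule (ZMod 2) (↥(Squares A B) → ZMod 2) where
  carrier := {x | ∀ g : G, lview0 A B x g ∈ dualCode (tensorCode CA CB)}
  add_mem' := by
    intro x y hx hy g
    exact (dualCode (tensorCode CA CB)).add_mem (hx g) (hy g)
  zero_mem' := by
    intro g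
    exact (dualCode (tensorCode CA CB)).zero_mem
  smul_mem' := by
    intro t x hx g
    exact (dualCode (tensorCode CA CB)).smul_mem t (hx g)

/-- The classical code 𝒞₁ of the quantum Tanner code: all local views at
vertices of `V₁` lie in `C₁^⊥ = (C_A^⊥ ⊗ C_B^⊥)^⊥`. -/
def qC1 [Finite G] {A B : Set G} (hA : ∀ a ∈ A, a⁻¹ ∈ A)
    (CA : Submodule (ZMod 2) (↥A → ZMod 2)) (CB : Submodule (ZMod 2) (↥B → ZMod 2)) :
    Submodule (ZMod 2) (↥(Squares A B) → ZMod 2) where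
  carrier := {x | ∀ g : G, lview1 hA x g ∈ dualCode (tensorCode (dualCode CA) (dualCode CB))}
  add_mem' := by
    intro x y hx hy g
    exact (dualCode (tensorCode (dualCode CA) (dualCode CB))).add_mem (hx g) (hy g)
  zero_mem' := by
    intro g
    exact (dualCode (tensorCode (dualCode CA) (dualCode CB))).zero_mem
  smul_mem' := by
    intro t x hx g
    exact (dualCode (tensorCode (dualCode CA) (dualCode CB))).smul_mem t (hx g)

/-- Adjacency matrix of the left Cayley graph `Cay(G, A)`. -/
def cayAdjL (A : Set G) : Matrix G G ℝ :=
  fun g g' => A.indicator (fun _ => (1 : ℝ)) (g' * g⁻¹)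

/-- Adjacency matrix of the right Cayley graph `Cay(G, B)`. -/
def cayAdjR (B : Set G) : Matrix G G ℝ :=
  fun g g' => B.indicator (fun _ => (1 : ℝ)) (g⁻¹ * g')

end Complex

/-- A `Δ`-regular graph (given by its adjacency matrix) is Ramanujan if every
eigenvalue other than `±Δ` has absolute value at most `2√(Δ-1)`. -/
def IsRamanujan {V : Type*} [Fintype V] (M : Matrix V V ℝ) (Δ : ℝ) : Prop :=
  ∀ μ : ℝ, (∃ x : V → ℝ, x ≠ 0 ∧ M.mulVec x = μ • x) → μ ≠ Δ → μ ≠ -Δ →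
    |μ| ≤ 2 * Real.sqrt (Δ - 1)

/-- Probability of the event `S` under the uniform distribution on a finite type. -/
def unifProb {Ω : Type*} [Fintype Ω] (S : Set Ω) : ℝ :=
  (S.ncard : ℝ) / (Fintype.card Ω : ℝ)

end

section

open Matrix

/-- `X` is the sum of a matrix whose columns lie in `CA` and a matrix whose rows lie in `CB`. -/
def IsDualTensor {A B : Type*} (CA : Submodule (ZMod 2) (A → ZMod 2))
    (CB : Submodule (ZMod 2) (B → ZMod 2)) (X : Matrix A B (ZMod 2)) : Prop :=
  ∃ C R : Matrix A B (ZMod 2), (∀ b, C.col b ∈ CA) ∧ (∀ a, R.row a ∈ CB) ∧ X = C + R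

theorem isDualTensor_of_mem_dualTensor {A B : Type*} {CA : Submodule (ZMod 2) (A → ZMod 2)}
    {CB : Submodule (ZMod 2) (B → ZMod 2)} {c : A × B → ZMod 2} (hc : c ∈ dualTensor CA CB) :
    IsDualTensor CA CB (Matrix.of fun a b => c (a, b)) := by
  obtain ⟨x, hx, y, hy, rfl⟩ := Submodule.mem_sup.1 hc
  exact ⟨Matrix.of fun a b => x (a, b), Matrix.of fun a b => y (a, b), hx, hy, rfl⟩

section Sandwich

variable {A B A₂ B₂ : Type*} [Fintype A] [Fintype B]
  {CA : Submodule (ZMod 2) (A → ZMod 2)} {CB : Submodule (ZMod 2) (B → ZMod 2)}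
  {CA₂ : Submodule (ZMod 2) (A₂ → ZMod 2)} {CB₂ : Submodule (ZMod 2) (B₂ → ZMod 2)}
  {P : Matrix A₂ A (ZMod 2)} {Q : Matrix B₂ B (ZMod 2)}

theorem col_mul_mul_transpose_mem {C : Matrix A B (ZMod 2)} (hC : ∀ b, C.col b ∈ CA)
    (hP : ∀ x ∈ CA, P *ᵥ x ∈ CA₂) (b : B₂) : (P * C * Qᵀ).col b ∈ CA₂ := by
  have h : (P * C * Qᵀ).col b = P *ᵥ (C *ᵥ Q.row b) := by
    rw [mulVec_mulVec]
    ext a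
    simp [Matrix.mul_apply, mulVec, dotProduct, Matrix.col, Matrix.row]
  rw [h]
  refine hP _ ?_
  rw [mulVec_eq_sum]
  exact Submodule.sum_mem _ fun b _ => by
    simpa using! CA.smul_mem (Q.row _ b) (hC b)

theorem row_mul_mul_transpose_mem {R : Matrix A B (ZMod 2)} (hR : ∀ a, R.row a ∈ CB)
    (hQ : ∀ x ∈ CB, Q *ᵥ x ∈ CB₂) (a : A₂) : (P * R * Qᵀ).row a ∈ CB₂ := by
  have h := col_mul_mul_transpose_mem (C := Rᵀ) (P := Q) (Q := P) (CA := CB) (CA₂ := CB₂) hR hQ a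
  have h2 : Q * Rᵀ * Pᵀ = (P * R * Qᵀ)ᵀ := by
    simp [transpose_mul, Matrix.mul_assoc]
  rw [h2] at h
  exact h

theorem IsDualTensor.sandwich {X : Matrix A B (ZMod 2)} (hX : IsDualTensor CA CB X)
    (hP : ∀ x ∈ CA, P *ᵥ x ∈ CA₂) (hQ : ∀ x ∈ CB, Q *ᵥ x ∈ CB₂) :
    IsDualTensor CA₂ CB₂ (P * X * Qᵀ) := by
  obtain ⟨C, R, hC, hR, rfl⟩ := hX
  exact ⟨P * C * Qᵀ, P * R * Qᵀ, col_mul_mul_transpose_mem hC hP,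
    row_mul_mul_transpose_mem hR hQ, by rw [Matrix.mul_add, Matrix.add_mul]⟩

end Sandwich

/-- Restricting a matrix to subsets of coordinates punctures the codes. -/
theorem IsDualTensor.submatrix {A B α β : Type*}
    {CA : Submodule (ZMod 2) (A → ZMod 2)} {CB : Submodule (ZMod 2) (B → ZMod 2)}
    {X : Matrix A B (ZMod 2)}
    (hX : IsDualTensor CA CB X) (f : α → A) (g : β → B) :
    IsDualTensor (CA.map (LinearMap.funLeft (ZMod 2) (ZMod 2) f))
      (CB.map (LinearMap.funLeft (ZMod 2) (ZMod 2) g)) (X.submatrix f g) := by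
  obtain ⟨C, R, hC, hR, rfl⟩ := hX
  exact ⟨C.submatrix f g, R.submatrix f g, fun b => ⟨_, hC (g b), rfl⟩,
    fun a => ⟨_, hR (f a), rfl⟩, rfl⟩

/-- A linear section of the restriction map that lifts the punctured code into the code. -/
theorem exists_section_punctured {A α : Type*} [Fintype α] [Fintype A] [DecidableEq α]
    (C : Submodule (ZMod 2) (A → ZMod 2)) {f : α → A} (hf : Function.Injective f) :
    ∃ P : Matrix A α (ZMod 2), P.submatrix f id = 1 ∧
      ∀ x ∈ C.map (LinearMap.funLeft (ZMod 2) (ZMod 2) f), P *ᵥ x ∈ C := by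
  set L := LinearMap.funLeft (ZMod 2) (ZMod 2) f with hL
  obtain ⟨z, hz⟩ := L.exists_rightInverse_of_surjective
    (LinearMap.range_eq_top.2 (LinearMap.funLeft_surjective_of_injective _ _ _ hf))
  obtain ⟨g, hg⟩ := (L.submoduleMap C).exists_rightInverse_of_surjective
    (LinearMap.range_eq_top.2 (L.submoduleMap_surjective C))
  obtain ⟨p, hp⟩ := (C.map L).subtype.exists_leftInverse_of_injective (C.map L).ker_subtype
  have hz' : ∀ x, L (z x) = x := fun x => LinearMap.congr_fun hz x
  have hg' : ∀ x, L (g x : A → ZMod 2) = x := fun x =>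
    congrArg Subtype.val (LinearMap.congr_fun hg x)
  have hp' : ∀ x : C.map L, p x = x := fun x => LinearMap.congr_fun hp x
  let s : (α → ZMod 2) →ₗ[ZMod 2] (A → ZMod 2) :=
    z ∘ₗ (LinearMap.id - (C.map L).subtype ∘ₗ p) + C.subtype ∘ₗ g ∘ₗ p
  have hs : ∀ x, L (s x) = x := by
    intro x
    simp [s, hz', hg']
  have hsm : ∀ x, LinearMap.toMatrix' s *ᵥ x = s x := fun x => by
    rw [← Matrix.toLin'_apply, Matrix.toLin'_toMatrix']
  refine ⟨LinearMap.toMatrix' s, ?_, ?_⟩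
  · ext i j
    have h := congrFun (hs (Pi.single j 1)) i
    simp only [Matrix.submatrix_apply, id, LinearMap.toMatrix'_apply, Matrix.one_apply]
    rw [hL, LinearMap.funLeft_apply] at h
    rw [h]
    simp [Pi.single_apply]
  · intro x hx
    rw [hsm]
    have : p x = ⟨x, hx⟩ := hp' ⟨x, hx⟩
    simp [s, this]

theorem exists_basis_cols {K γ δ : Type*} [Field K] [Fintype δ]
    (Y : Matrix γ δ K) {r : ℕ} (hr : Y.rank = r) :
    ∃ J : Fin r → δ, LinearIndependent K (Y.submatrix id J).col ∧
      Submodule.span K (Set.range (Y.submatrix id J).col) =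
        Submodule.span K (Set.range Y.col) := by
  obtain ⟨κ, a, ha, hsp, hli⟩ := exists_linearIndependent' K Y.col
  have := Finite.of_injective a ha
  have := Fintype.ofFinite κ
  have hc : Fintype.card κ = r := by
    rw [← hr, Y.rank_eq_finrank_span_cols, ← hsp, finrank_span_eq_card hli]
  let e : Fin r ≃ κ := (Fintype.equivFinOfCardEq hc).symm
  refine ⟨a ∘ e, hli.comp e e.injective, ?_⟩
  rw [← hsp]
  congr 1
  exact e.surjective.range_comp (Y.col ∘ a)

/-- A rank factorization through a nonsingular square submatrix. -/
theorem exists_skeleton {K α β : Type*} [Field K] [Fintype α] [Fintype β]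
    (X : Matrix α β K) : ∃ (I : Fin X.rank → α) (J : Fin X.rank → β),
      IsUnit (X.submatrix I J) ∧
        X = X.submatrix id J * (X.submatrix I J)⁻¹ * X.submatrix I id := by
  obtain ⟨J, hJ, hsp⟩ := exists_basis_cols X rfl
  have hr : (X.submatrix id J)ᵀ.rank = X.rank := by
    have := LinearIndependent.rank_matrix (M := (X.submatrix id J)ᵀ) hJ
    simpa using this
  obtain ⟨I, hI, -⟩ := exists_basis_cols (X.submatrix id J)ᵀ hr
  have hu : IsUnit (X.submatrix I J) := by
    rw [← linearIndependent_rows_iff_isUnit]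
    exact hI
  refine ⟨I, J, hu, ?_⟩
  have hM : ∃ M : Matrix (Fin X.rank) β K, X = X.submatrix id J * M := by
    have : ∀ b, ∃ v, X.submatrix id J *ᵥ v = X.col b := by
      intro b
      have hb : X.col b ∈ Submodule.span K (Set.range (X.submatrix id J).col) := by
        rw [hsp]; exact Submodule.subset_span ⟨b, rfl⟩
      rw [← Matrix.range_mulVecLin] at hb
      obtain ⟨v, hv⟩ := hb
      exact ⟨v, hv⟩
    choose M hM using this
    refine ⟨(Matrix.of M)ᵀ, ?_⟩
    ext a b
    exact (congrFun (hM b) a).symm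
  obtain ⟨M, hM⟩ := hM
  have h1 : X.submatrix I id = X.submatrix I J * M :=
    congrArg (fun Y => Matrix.submatrix Y I id) hM
  rw [h1, Matrix.mul_assoc, Matrix.nonsing_inv_mul_cancel_left _ _
    ((Matrix.isUnit_iff_isUnit_det _).1 hu)]
  exact hM

section Weight

variable {ι κ : Type*}

theorem wt_eq_sum [Fintype ι] (x : ι → ZMod 2) : wt x = ∑ i, if x i ≠ 0 then 1 else 0 := by
  classical
  rw [wt, Set.ncard_eq_toFinset_card', Finset.sum_boole]
  simp

theorem wt_zero : wt (0 : ι → ZMod 2) = 0 := by simp [wt]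

theorem wt_comp_le [Finite ι] {f : κ → ι} (hf : Function.Injective f) (x : ι → ZMod 2) :
    wt (x ∘ f) ≤ wt x := by
  rw [wt, wt, ← Set.ncard_image_of_injective _ hf]
  exact Set.ncard_le_ncard (by rintro _ ⟨i, hi, rfl⟩; exact hi)

theorem wt_le_wt_comp_add [Fintype ι] [Fintype κ] {f : κ → ι} (hf : Function.Injective f)
    (x : ι → ZMod 2) : wt x + Fintype.card κ ≤ wt (x ∘ f) + Fintype.card ι := by
  classical
  have h1 : {i | x i ≠ 0} ⊆ f '' {k | (x ∘ f) k ≠ 0} ∪ (Set.range f)ᶜ := by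
    intro i hi
    by_cases h : i ∈ Set.range f
    · obtain ⟨k, rfl⟩ := h
      exact Or.inl ⟨k, hi, rfl⟩
    · exact Or.inr h
  have h2 := (Set.ncard_le_ncard h1).trans (Set.ncard_union_le _ _)
  rw [Set.ncard_image_of_injective _ hf] at h2
  have h3 := Set.ncard_add_ncard_compl (Set.range f)
  rw [← Set.image_univ, Set.ncard_image_of_injective _ hf, Set.ncard_univ, Set.image_univ,
    Nat.card_eq_fintype_card, Nat.card_eq_fintype_card] at h3
  simp only [wt]
  omega

theorem minDist_le_wt {C : Submodule (ZMod 2) (ι → ZMod 2)} {x : ι → ZMod 2} (hx : x ∈ C)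
    (h0 : x ≠ 0) : minDist C ≤ wt x :=
  Nat.sInf_le ⟨x, hx, h0, rfl⟩

theorem lt_minDist {C : Submodule (ZMod 2) (ι → ZMod 2)} {η : ℝ}
    (hC : ∀ x ∈ C, (wt x : ℝ) ≤ η → x = 0) {x : ι → ZMod 2} (hx : x ∈ C) (h0 : x ≠ 0) :
    η < minDist C := by
  obtain ⟨y, hy, hy0, hyd⟩ := Nat.sInf_mem (s := {d : ℕ | ∃ c ∈ C, c ≠ 0 ∧ wt c = d})
    ⟨_, x, hx, h0, rfl⟩
  by_contra hlt
  refine hy0 (hC y hy ?_)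
  rw [hyd]
  exact not_lt.1 hlt

end Weight

/-- No matrix of the dual tensor code has a skeleton decomposition into rows and columns of
weight at most `t`. -/
def NoLightSkeleton {n : ℕ} (CA CB : Submodule (ZMod 2) (Fin n → ZMod 2)) (t : ℝ) : Prop :=
  ∀ (r : ℕ) (U V : Matrix (Fin r) (Fin n) (ZMod 2)) (I : Fin r → Fin n), 0 < r →
    (∀ j, (wt (U j) : ℝ) ≤ t) → (∀ j, (wt (V j) : ℝ) ≤ t) →
    IsUnit (Uᵀ.submatrix I id) → LinearIndependent (ZMod 2) V.row →
    ¬ IsDualTensor CA CB (Uᵀ * (Uᵀ.submatrix I id)⁻¹ * V)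

theorem wt_mulVec_le {n : ℕ} {α : Type*} [Fintype α] [DecidableEq α] {f : α → Fin n}
    (hf : Function.Injective f) {t η σ : ℝ} (ht : η + σ ≤ t)
    (hα : (n : ℝ) ≤ Fintype.card α + σ) {P : Matrix (Fin n) α (ZMod 2)}
    (hP : P.submatrix f id = 1) {x : α → ZMod 2} (hx : (wt x : ℝ) ≤ η) :
    (wt (P *ᵥ x) : ℝ) ≤ t := by
  have h1 : (P *ᵥ x) ∘ f = x := by
    have : (P.submatrix f id) *ᵥ x = x := by rw [hP, one_mulVec]
    exact this
  have h2 := wt_le_wt_comp_add hf (P *ᵥ x)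
  rw [h1, Fintype.card_fin] at h2
  have h3 : (wt (P *ᵥ x) : ℝ) + Fintype.card α ≤ wt x + n := by exact_mod_cast h2
  linarith

theorem NoLightSkeleton.eq_zero {n : ℕ} {CA CB : Submodule (ZMod 2) (Fin n → ZMod 2)}
    {t η σ : ℝ} (h : NoLightSkeleton CA CB t) (ht : η + σ ≤ t) {α β : Type*} [Fintype α]
    [Fintype β] {f : α → Fin n} {g : β → Fin n} (hf : Function.Injective f)
    (hg : Function.Injective g) (hα : (n : ℝ) ≤ Fintype.card α + σ)
    (hβ : (n : ℝ) ≤ Fintype.card β + σ) {X : Matrix α β (ZMod 2)}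
    (hX : IsDualTensor (CA.map (LinearMap.funLeft (ZMod 2) (ZMod 2) f))
      (CB.map (LinearMap.funLeft (ZMod 2) (ZMod 2) g)) X)
    (hcol : ∀ b, (wt (X.col b) : ℝ) ≤ η) (hrow : ∀ a, (wt (X.row a) : ℝ) ≤ η) : X = 0 := by
  classical
  by_contra hX0
  obtain ⟨I, J, hIJ, hskel⟩ := exists_skeleton X
  obtain ⟨P, hP, hPC⟩ := exists_section_punctured CA hf
  obtain ⟨Q, hQ, hQC⟩ := exists_section_punctured CB hg
  have hr : 0 < X.rank := by
    rw [Nat.pos_iff_ne_zero]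
    intro h0
    have : IsEmpty (Fin X.rank) := by rw [h0]; infer_instance
    apply hX0
    rw [hskel]
    ext a b
    simp [Matrix.mul_apply]
  have hU : ((P * X.submatrix id J)ᵀᵀ).submatrix (f ∘ I) id = X.submatrix I J := by
    rw [transpose_transpose]
    calc (P * X.submatrix id J).submatrix (f ∘ I) id
        = (P.submatrix f id * X.submatrix id J).submatrix I id := rfl
      _ = X.submatrix I J := by rw [hP, Matrix.one_mul]; rfl
  have hV : (X.submatrix I id * Qᵀ).submatrix id (g ∘ J) = X.submatrix I J := by
    calc (X.submatrix I id * Qᵀ).submatrix id (g ∘ J)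
        = (X.submatrix I id * (Q.submatrix g id)ᵀ).submatrix id J := rfl
      _ = X.submatrix I J := by rw [hQ, Matrix.transpose_one, Matrix.mul_one]; rfl
  refine h X.rank (P * X.submatrix id J)ᵀ (X.submatrix I id * Qᵀ) (f ∘ I) hr ?_ ?_ ?_ ?_ ?_
  · intro j
    exact wt_mulVec_le hf ht hα hP (hcol (J j))
  · intro j
    have : (X.submatrix I id * Qᵀ) j = Q *ᵥ X.row (I j) := by
      ext b
      simp [Matrix.mul_apply, mulVec, dotProduct, Matrix.row, mul_comm]
    rw [this]
    exact wt_mulVec_le hg ht hβ hQ (hrow (I j))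
  · rw [hU]
    exact hIJ
  · have h1 := linearIndependent_rows_iff_isUnit.2 hIJ
    rw [← hV] at h1
    exact LinearIndependent.of_comp (LinearMap.funLeft (ZMod 2) (ZMod 2) (g ∘ J)) h1
  · rw [hU, transpose_transpose]
    have : P * X.submatrix id J * (X.submatrix I J)⁻¹ * (X.submatrix I id * Qᵀ) = P * X * Qᵀ := by
      conv_rhs => rw [hskel]
      simp only [Matrix.mul_assoc]
    rw [this]
    exact hX.sandwich hPC hQC

theorem IsDualTensor.transpose {A B : Type*} {CA : Submodule (ZMod 2) (A → ZMod 2)}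
    {CB : Submodule (ZMod 2) (B → ZMod 2)} {X : Matrix A B (ZMod 2)}
    (hX : IsDualTensor CA CB X) : IsDualTensor CB CA Xᵀ := by
  obtain ⟨C, R, hC, hR, rfl⟩ := hX
  exact ⟨Rᵀ, Cᵀ, hR, hC, by rw [transpose_add, add_comm]⟩

/-- If the dual tensor code has no nonzero matrix with light rows and columns, then the
column code has no light words. -/
theorem eq_zero_of_wt_le {A B : Type*} [Fintype A] [Fintype B] [Nonempty B]
    {CA : Submodule (ZMod 2) (A → ZMod 2)} {CB : Submodule (ZMod 2) (B → ZMod 2)} {η : ℝ}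
    (hη : 1 ≤ η) (h : ∀ X : Matrix A B (ZMod 2), IsDualTensor CA CB X →
      (∀ b, (wt (X.col b) : ℝ) ≤ η) → (∀ a, (wt (X.row a) : ℝ) ≤ η) → X = 0)
    {x : A → ZMod 2} (hx : x ∈ CA) (hw : (wt x : ℝ) ≤ η) : x = 0 := by
  classical
  obtain ⟨b₀⟩ := ‹Nonempty B›
  let X : Matrix A B (ZMod 2) := Matrix.of fun a b => if b = b₀ then x a else 0
  have hcol : ∀ b, X.col b = if b = b₀ then x else 0 := by
    intro b
    ext a
    by_cases hb : b = b₀ <;> simp [X, Matrix.col, hb]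
  have hX : X = 0 := by
    refine h X ⟨X, 0, ?_, fun a => CB.zero_mem, (add_zero X).symm⟩ ?_ ?_
    · intro b
      rw [hcol]
      split_ifs
      · exact hx
      · exact CA.zero_mem
    · intro b
      rw [hcol]
      split_ifs
      · exact hw
      · rw [wt_zero]; push_cast; linarith
    · intro a
      have : wt (X.row a) ≤ 1 := by
        rw [wt_eq_sum, ← Finset.sum_filter]
        simp only [Finset.sum_const, smul_eq_mul, mul_one]
        rw [Finset.card_le_one]
        intro b hb b' hb'
        simp only [X, Matrix.row, Matrix.of_apply] at hb hb'
        have h1 : b = b₀ := by by_contra hne; simp [hne] at hb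
        have h2 : b' = b₀ := by by_contra hne; simp [hne] at hb'
        rw [h1, h2]
      have : (wt (X.row a) : ℝ) ≤ 1 := by exact_mod_cast this
      linarith
  have h0 := hcol b₀
  rw [if_pos rfl, hX] at h0
  exact h0.symm

theorem ncard_eq_sum {ι : Type*} [Fintype ι] (S : Set ι) [DecidablePred (· ∈ S)] :
    S.ncard = ∑ i, if i ∈ S then 1 else 0 := by
  rw [Set.ncard_eq_toFinset_card', ← Finset.card_filter]
  congr 1
  ext
  simp

theorem minDist_mul_ncard_le {ι κ : Type*} [Fintype ι] {D : Submodule (ZMod 2) (κ → ZMod 2)}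
    (x : ι → κ → ZMod 2) (hx : ∀ i, x i ∈ D) :
    minDist D * {i | x i ≠ 0}.ncard ≤ ∑ i, wt (x i) := by
  classical
  rw [Set.ncard_eq_toFinset_card', mul_comm, ← smul_eq_mul, ← Finset.sum_const]
  refine (Finset.sum_le_sum fun i hi => ?_).trans
    (Finset.sum_le_sum_of_subset (Finset.subset_univ _))
  exact minDist_le_wt (hx i) (by simpa using hi)

section Robust

variable {A B : Type*} [Fintype A] [Fintype B]

theorem wt_eq_sum_row (X : Matrix A B (ZMod 2)) :
    wt (fun p : A × B => X p.1 p.2) = ∑ a, wt (X.row a) := by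
  rw [wt_eq_sum, Fintype.sum_prod_type]
  exact Finset.sum_congr rfl fun a _ => (wt_eq_sum _).symm

theorem wt_transpose (X : Matrix A B (ZMod 2)) :
    wt (fun p : B × A => Xᵀ p.1 p.2) = wt (fun p : A × B => X p.1 p.2) := by
  rw [wt_eq_sum, wt_eq_sum, Fintype.sum_prod_type, Fintype.sum_prod_type, Finset.sum_comm]
  rfl

theorem ncard_heavy_rows_le (X : Matrix A B (ZMod 2)) {η s : ℝ} (hη : 0 < η)
    (hw : (wt (fun p : A × B => X p.1 p.2) : ℝ) ≤ s * η) :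
    ({a | η < wt (X.row a)}.ncard : ℝ) ≤ s := by
  classical
  have h1 : ({a | η < wt (X.row a)}.ncard : ℝ) * η ≤ ∑ a, (wt (X.row a) : ℝ) := by
    rw [Set.ncard_eq_toFinset_card', ← nsmul_eq_mul, ← Finset.sum_const]
    refine (Finset.sum_le_sum fun a ha => ?_).trans
      (Finset.sum_le_sum_of_subset_of_nonneg (Finset.subset_univ _) fun _ _ _ => by positivity)
    have : η < wt (X.row a) := by simpa using ha
    exact this.le
  rw [wt_eq_sum_row] at hw
  push_cast at hw
  exact le_of_mul_le_mul_right (h1.trans hw) hη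

/-- A lower bound for the weight of a sum of a matrix supported on few columns and a matrix
supported on few rows. -/
theorem minDist_mul_le_wt_add {CA : Submodule (ZMod 2) (A → ZMod 2)}
    {CB : Submodule (ZMod 2) (B → ZMod 2)} {C R : Matrix A B (ZMod 2)}
    (hC : ∀ b, C.col b ∈ CA) (hR : ∀ a, R.row a ∈ CB) :
    minDist CA * {b | C.col b ≠ 0}.ncard + minDist CB * {a | R.row a ≠ 0}.ncard ≤
      wt (fun p : A × B => (C + R) p.1 p.2) +
        2 * ({a | R.row a ≠ 0}.ncard * {b | C.col b ≠ 0}.ncard) := by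
  classical
  set SA := {a | R.row a ≠ 0} with hSA
  set SB := {b | C.col b ≠ 0} with hSB
  have h1 := minDist_mul_ncard_le (fun b => C.col b) hC
  have h2 := minDist_mul_ncard_le (fun a => R.row a) hR
  have h3 : SA.ncard * SB.ncard = ∑ a, ∑ b, if a ∈ SA ∧ b ∈ SB then 1 else 0 := by
    have key : ∀ {x y : Prop} [Decidable x] [Decidable y],
        (if x ∧ y then 1 else 0 : ℕ) = (if x then 1 else 0) * (if y then 1 else 0) := by
      intro x y _ _
      by_cases x <;> by_cases y <;> simp [*]
    simp_rw [key, ← Finset.mul_sum]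
    rw [← Finset.sum_mul]
    rw [← ncard_eq_sum, ← ncard_eq_sum]
  have hcols : ∑ b, wt (C.col b) = ∑ a, ∑ b, if C a b ≠ 0 then 1 else 0 := by
    rw [Finset.sum_comm]
    exact Finset.sum_congr rfl fun b _ => wt_eq_sum _
  have hrows : ∑ a, wt (R.row a) = ∑ a, ∑ b, if R a b ≠ 0 then 1 else 0 :=
    Finset.sum_congr rfl fun a _ => wt_eq_sum _
  have h4 : ∑ b, wt (C.col b) + ∑ a, wt (R.row a) ≤
      wt (fun p : A × B => (C + R) p.1 p.2) + 2 * (SA.ncard * SB.ncard) := by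
    rw [h3, hcols, hrows, wt_eq_sum, Fintype.sum_prod_type, Finset.mul_sum,
      ← Finset.sum_add_distrib, ← Finset.sum_add_distrib]
    refine Finset.sum_le_sum fun a _ => ?_
    rw [Finset.mul_sum, ← Finset.sum_add_distrib, ← Finset.sum_add_distrib]
    refine Finset.sum_le_sum fun b _ => ?_
    have ha : R a b ≠ 0 → a ∈ SA := fun h h0 => h (congrFun h0 b)
    have hb : C a b ≠ 0 → b ∈ SB := fun h h0 => h (congrFun h0 a)
    by_cases hRab : R a b = 0
    · by_cases hCab : C a b = 0 <;> simp [hRab, hCab]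
    · by_cases hCab : C a b = 0
      · simp [hRab, hCab]
      · simp only [ha hRab, hb hCab, hRab, hCab, ne_eq, not_false_eq_true, and_self, if_true]
        omega
  exact (Nat.add_le_add h1 h2).trans h4

theorem isRobust_of_light_eq_zero {CA : Submodule (ZMod 2) (A → ZMod 2)}
    {CB : Submodule (ZMod 2) (B → ZMod 2)} {η w s : ℝ} (hη : 0 < η) (hw : w ≤ s * η)
    (hs : 2 * s ≤ η) (hA : ∀ x ∈ CA, (wt x : ℝ) ≤ η → x = 0)
    (hB : ∀ x ∈ CB, (wt x : ℝ) ≤ η → x = 0)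
    (h : ∀ (A₁ : Set A) (B₁ : Set B), (A₁.ncard : ℝ) ≤ s → (B₁.ncard : ℝ) ≤ s →
      ∀ X : Matrix ↥A₁ᶜ ↥B₁ᶜ (ZMod 2), IsDualTensor (punct CA A₁ᶜ) (punct CB B₁ᶜ) X →
      (∀ b, (wt (X.col b) : ℝ) ≤ η) → (∀ a, (wt (X.row a) : ℝ) ≤ η) → X = 0) :
    IsRobust CA CB w := by
  classical
  intro c hc hcw
  set X : Matrix A B (ZMod 2) := Matrix.of fun a b => c (a, b) with hXdef
  have hcX : c = fun p : A × B => X p.1 p.2 := rfl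
  set A₁ := {a | η < wt (X.row a)} with hA₁
  set B₁ := {b | η < wt (Xᵀ.row b)} with hB₁
  have hA₁s : (A₁.ncard : ℝ) ≤ s := ncard_heavy_rows_le X hη (hcw.trans hw)
  have hB₁s : (B₁.ncard : ℝ) ≤ s :=
    ncard_heavy_rows_le Xᵀ hη (by rw [wt_transpose]; exact hcw.trans hw)
  have hXd := isDualTensor_of_mem_dualTensor hc
  have hzero : X.submatrix (Subtype.val : ↥A₁ᶜ → A) (Subtype.val : ↥B₁ᶜ → B) = 0 := by
    refine h A₁ B₁ hA₁s hB₁s _ (hXd.submatrix _ _) (fun b => ?_) fun a => ?_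
    · have h1 : (wt (X.col b) : ℝ) ≤ η := not_lt.1 b.2
      refine le_trans ?_ h1
      exact_mod_cast wt_comp_le Subtype.val_injective (X.col b)
    · have h1 : (wt (X.row a) : ℝ) ≤ η := not_lt.1 a.2
      refine le_trans ?_ h1
      exact_mod_cast wt_comp_le Subtype.val_injective (X.row a)
  obtain ⟨C, R, hC, hR, hCR⟩ := hXd
  obtain ⟨P, hP, hPC⟩ := exists_section_punctured CA (Subtype.val_injective (p := (· ∈ A₁ᶜ)))
  obtain ⟨Q, hQ, hQC⟩ := exists_section_punctured CB (Subtype.val_injective (p := (· ∈ B₁ᶜ)))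
  set T := C.submatrix (Subtype.val : ↥A₁ᶜ → A) (Subtype.val : ↥B₁ᶜ → B) with hT
  have hTR : T = -R.submatrix (Subtype.val : ↥A₁ᶜ → A) (Subtype.val : ↥B₁ᶜ → B) := by
    rw [eq_neg_iff_add_eq_zero, ← hzero, hXdef, hCR]
    rfl
  set E := P * T * Qᵀ with hE
  have hEC : ∀ b, E.col b ∈ CA :=
    col_mul_mul_transpose_mem (CA := punct CA A₁ᶜ) (fun b => ⟨_, hC b, rfl⟩) hPC
  have hER : ∀ a, E.row a ∈ CB := by
    refine row_mul_mul_transpose_mem (CB := punct CB B₁ᶜ) (fun a => ?_) hQC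
    rw [hTR]
    exact (punct CB B₁ᶜ).neg_mem ⟨_, hR a, rfl⟩
  have hET : E.submatrix (Subtype.val : ↥A₁ᶜ → A) (Subtype.val : ↥B₁ᶜ → B) = T := by
    calc E.submatrix (Subtype.val : ↥A₁ᶜ → A) (Subtype.val : ↥B₁ᶜ → B)
        = P.submatrix Subtype.val id * T * (Q.submatrix Subtype.val id)ᵀ := rfl
      _ = T := by rw [hP, hQ, Matrix.one_mul, Matrix.transpose_one, Matrix.mul_one]
  have hC' : ∀ b, (C - E).col b ∈ CA := fun b => CA.sub_mem (hC b) (hEC b)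
  have hR' : ∀ a, (R + E).row a ∈ CB := fun a => CB.add_mem (hR a) (hER a)
  have hX' : X = (C - E) + (R + E) := by rw [hXdef, hCR]; abel
  have hs0 : s ≤ η := by
    have : (0 : ℝ) ≤ A₁.ncard := by positivity
    linarith
  have hSB : {b | (C - E).col b ≠ 0} ⊆ B₁ := by
    intro b hb
    by_contra hbB
    refine hb (hA _ (hC' b) (le_trans ?_ (hA₁s.trans hs0)))
    refine Nat.cast_le.2 (Set.ncard_le_ncard fun a ha => ?_)
    by_contra haA
    refine ha ?_
    have := congrFun (congrFun hET ⟨a, haA⟩) ⟨b, hbB⟩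
    exact sub_eq_zero.2 this.symm
  have hSA : {a | (R + E).row a ≠ 0} ⊆ A₁ := by
    intro a ha
    by_contra haA
    refine ha (hB _ (hR' a) (le_trans ?_ (hB₁s.trans hs0)))
    refine Nat.cast_le.2 (Set.ncard_le_ncard fun b hb => ?_)
    by_contra hbB
    refine hb ?_
    have h1 := congrFun (congrFun hET ⟨a, haA⟩) ⟨b, hbB⟩
    rw [hTR] at h1
    have h2 : E a b = -R a b := h1
    change R a b + E a b = 0
    rw [h2, add_neg_cancel]
  have hcount := minDist_mul_le_wt_add hC' hR'
  rw [← hX', ← hcX] at hcount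
  set SA := {a | (R + E).row a ≠ 0} with hSAdef
  set SB := {b | (C - E).col b ≠ 0} with hSBdef
  have hcount' : (minDist CA : ℝ) * SB.ncard + minDist CB * SA.ncard ≤
      wt c + 2 * (SA.ncard * SB.ncard) := by exact_mod_cast hcount
  have hSAs : (SA.ncard : ℝ) ≤ s := le_trans (Nat.cast_le.2 (Set.ncard_le_ncard hSA)) hA₁s
  have hSBs : (SB.ncard : ℝ) ≤ s := le_trans (Nat.cast_le.2 (Set.ncard_le_ncard hSB)) hB₁s
  have hdB : SA.Nonempty → η < minDist CB := fun ⟨a, ha⟩ => lt_minDist hB (hR' a) ha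
  have hdA : SB.Nonempty → η < minDist CA := fun ⟨b, hb⟩ => lt_minDist hA (hC' b) hb
  have hA2 : 2 * ((SA.ncard : ℝ) * SB.ncard) ≤ minDist CA * SB.ncard := by
    rcases SB.eq_empty_or_nonempty with h0 | h0
    · simp [h0]
    · have := hdA h0
      nlinarith [(Nat.cast_nonneg SB.ncard : (0 : ℝ) ≤ SB.ncard)]
  have hB2 : 2 * ((SA.ncard : ℝ) * SB.ncard) ≤ minDist CB * SA.ncard := by
    rcases SA.eq_empty_or_nonempty with h0 | h0
    · simp [h0]
    · have := hdB h0
      nlinarith [(Nat.cast_nonneg SA.ncard : (0 : ℝ) ≤ SA.ncard)]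
  refine ⟨SA, SB, ?_, ?_, ?_⟩
  · rcases SA.eq_empty_or_nonempty with h0 | h0
    · rw [h0, Set.ncard_empty, Nat.cast_zero]
      exact div_nonneg (Nat.cast_nonneg _) (Nat.cast_nonneg _)
    · rw [le_div_iff₀ (hη.trans (hdB h0))]
      linarith
  · rcases SB.eq_empty_or_nonempty with h0 | h0
    · rw [h0, Set.ncard_empty, Nat.cast_zero]
      exact div_nonneg (Nat.cast_nonneg _) (Nat.cast_nonneg _)
    · rw [le_div_iff₀ (hη.trans (hdA h0))]
      linarith
  · intro a b ha hb
    have h1 : (R + E).row a = 0 := by simpa [hSAdef] using ha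
    have h2 : (C - E).col b = 0 := by simpa [hSBdef] using hb
    have h3 : (R + E) a b = 0 := congrFun h1 b
    have h4 : (C - E) a b = 0 := congrFun h2 a
    change X a b = 0
    rw [hX', Matrix.add_apply, h3, h4, add_zero]

end Robust

/-- If the dual tensor code has no light skeleton, it is robust with resistance to puncturing. -/
theorem NoLightSkeleton.isRobustPunct {n : ℕ} {CA CB : Submodule (ZMod 2) (Fin n → ZMod 2)}
    {t η σ w p s : ℝ} (h : NoLightSkeleton CA CB t) (ht : η + σ ≤ t) (hη : 1 ≤ η)
    (hs0 : 0 ≤ s) (hw : w ≤ s * η) (hs : 2 * s ≤ η) (hp : p + s ≤ σ) (hn : σ < n) :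
    IsRobustPunct CA CB w p := by
  classical
  intro A' B' w' hw' hA hB
  rw [Nat.card_fin, ← Nat.card_coe_set_eq, Nat.card_eq_fintype_card] at hA hB
  have hA' : (Fintype.card A' : ℝ) + w' = n := by exact_mod_cast hA
  have hB' : (Fintype.card B' : ℝ) + w' = n := by exact_mod_cast hB
  have hne : ∀ S : Set (Fin n), (Fintype.card S : ℝ) + w' = n → Nonempty S := by
    intro S hS
    rw [← Fintype.card_pos_iff, ← Nat.cast_pos (α := ℝ)]
    linarith
  have := hne A' hA'
  have := hne B' hB'
  have hlight : ∀ X : Matrix A' B' (ZMod 2), IsDualTensor (punct CA A') (punct CB B') X →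
      (∀ b, (wt (X.col b) : ℝ) ≤ η) → (∀ a, (wt (X.row a) : ℝ) ≤ η) → X = 0 :=
    fun X hX hcol hrow => h.eq_zero ht Subtype.val_injective Subtype.val_injective
      (by linarith) (by linarith) hX hcol hrow
  refine isRobust_of_light_eq_zero (by linarith) hw hs
    (fun x hx hxw => eq_zero_of_wt_le hη hlight hx hxw)
    (fun x hx hxw => eq_zero_of_wt_le hη (fun X hX hcol hrow =>
      Matrix.transpose_eq_zero.1 (hlight Xᵀ hX.transpose hrow hcol)) hx hxw)
    fun A₁ B₁ hA₁ hB₁ X hX hcol hrow => ?_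
  have hcard : ∀ (S : Set (Fin n)) (S₁ : Set S), (Fintype.card S : ℝ) + w' = n →
      (S₁.ncard : ℝ) ≤ s → (n : ℝ) ≤ Fintype.card ↥S₁ᶜ + σ := by
    intro S S₁ hS hS₁
    have h1 := Set.ncard_add_ncard_compl S₁
    rw [← Nat.card_coe_set_eq S₁ᶜ, Nat.card_eq_fintype_card, Nat.card_eq_fintype_card] at h1
    have h2 : (S₁.ncard : ℝ) + Fintype.card ↥S₁ᶜ = Fintype.card S := by exact_mod_cast h1
    linarith
  have hpunct : ∀ (D : Submodule (ZMod 2) (Fin n → ZMod 2)) (S : Set (Fin n)) (S₁ : Set S),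
      punct (punct D S) S₁ᶜ = D.map (LinearMap.funLeft (ZMod 2) (ZMod 2)
        (Subtype.val ∘ Subtype.val : ↥S₁ᶜ → Fin n)) := by
    intro D S S₁
    rw [punct, punct, ← Submodule.map_comp]
    rfl
  rw [hpunct, hpunct] at hX
  exact h.eq_zero ht (Subtype.val_injective.comp Subtype.val_injective)
    (Subtype.val_injective.comp Subtype.val_injective) (hcard A' A₁ hA' hA₁)
    (hcard B' B₁ hB' hB₁) hX hcol hrow

section UnifProb

variable {Ω Ω' : Type*} [Fintype Ω] [Fintype Ω']

theorem unifProb_nonneg (S : Set Ω) : 0 ≤ unifProb S :=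
  div_nonneg (Nat.cast_nonneg _) (Nat.cast_nonneg _)

theorem unifProb_mono {S T : Set Ω} (h : S ⊆ T) : unifProb S ≤ unifProb T :=
  div_le_div_of_nonneg_right (Nat.cast_le.2 (Set.ncard_le_ncard h)) (Nat.cast_nonneg _)

theorem unifProb_le_one (S : Set Ω) : unifProb S ≤ 1 := by
  refine div_le_one_of_le₀ (Nat.cast_le.2 ?_) (Nat.cast_nonneg _)
  rw [← Nat.card_eq_fintype_card]
  exact Set.ncard_le_card S

theorem unifProb_union_le (S T : Set Ω) : unifProb (S ∪ T) ≤ unifProb S + unifProb T := by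
  rw [unifProb, unifProb, unifProb, ← add_div]
  exact div_le_div_of_nonneg_right (by exact_mod_cast Set.ncard_union_le S T) (Nat.cast_nonneg _)

theorem one_sub_unifProb_compl_le [Nonempty Ω] (S : Set Ω) : 1 - unifProb Sᶜ ≤ unifProb S := by
  have h := unifProb_union_le S Sᶜ
  rw [Set.union_compl_self, unifProb, Set.ncard_univ, Nat.card_eq_fintype_card,
    div_self (by positivity)] at h
  linarith

theorem unifProb_biUnion_le {ι : Type*} (s : Finset ι) (S : ι → Set Ω) :
    unifProb (⋃ i ∈ s, S i) ≤ ∑ i ∈ s, unifProb (S i) := by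
  classical
  induction s using Finset.induction_on with
  | empty => simp [unifProb]
  | insert a s ha ih =>
    rw [Finset.set_biUnion_insert, Finset.sum_insert ha]
    exact (unifProb_union_le _ _).trans (by gcongr)

theorem unifProb_exists_le {ι : Type*} [Fintype ι] (Q : ι → Prop) (P : ι → Ω → Prop) {b : ℝ}
    (h : ∀ i, Q i → unifProb {ω | P i ω} ≤ b) :
    unifProb {ω | ∃ i, Q i ∧ P i ω} ≤ {i | Q i}.ncard * b := by
  classical
  have h1 : {ω | ∃ i, Q i ∧ P i ω} = ⋃ i ∈ Finset.univ.filter Q, {ω | P i ω} := by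
    ext ω
    simp
  rw [h1]
  refine (unifProb_biUnion_le _ _).trans ?_
  refine (Finset.sum_le_card_nsmul _ _ b fun i hi => h i (Finset.mem_filter.1 hi).2).trans_eq ?_
  rw [nsmul_eq_mul, Set.ncard_eq_toFinset_card']
  congr 3
  ext
  simp

theorem unifProb_preimage_equiv (e : Ω ≃ Ω') (S : Set Ω') : unifProb (e ⁻¹' S) = unifProb S := by
  rw [unifProb, unifProb, Fintype.card_congr e, ← e.image_symm_eq_preimage,
    Set.ncard_image_of_injective _ e.symm.injective]

theorem unifProb_prod_le [Nonempty Ω] [Nonempty Ω'] {S : Set (Ω × Ω')} {b : ℝ}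
    (h : ∀ y, unifProb {x | (x, y) ∈ S} ≤ b) : unifProb S ≤ b := by
  classical
  have h1 : S.ncard = ∑ y, {x | (x, y) ∈ S}.ncard := by
    rw [ncard_eq_sum, Fintype.sum_prod_type, Finset.sum_comm]
    refine Finset.sum_congr rfl fun y _ => ?_
    rw [ncard_eq_sum]
    rfl
  rw [unifProb, h1, div_le_iff₀ (by positivity), Fintype.card_prod]
  push_cast
  have h2 : ∀ y, ({x | (x, y) ∈ S}.ncard : ℝ) ≤ b * Fintype.card Ω := fun y => by
    have := h y
    rwa [unifProb, div_le_iff₀ (by positivity)] at this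
  refine (Finset.sum_le_sum fun y _ => h2 y).trans_eq ?_
  rw [Finset.sum_const, nsmul_eq_mul, Finset.card_univ]
  ring

end UnifProb

theorem card_matrix_zmod_two {σ κ : Type*} [Fintype σ] [Fintype κ] [DecidableEq σ]
    [DecidableEq κ] [Fintype (Matrix σ κ (ZMod 2))] :
    Fintype.card (Matrix σ κ (ZMod 2)) = 2 ^ (Fintype.card σ * Fintype.card κ) := by
  rw [Fintype.card_congr (Matrix.of (m := σ) (n := κ) (α := ZMod 2)).symm, Fintype.card_fun,
    Fintype.card_fun, ZMod.card, ← pow_mul, mul_comm]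

/-- A uniformly random matrix is mapped by left multiplication with a matrix of full row rank to a
uniformly random matrix. -/
theorem unifProb_mul_eq_le {σ κ ν : Type*} [Fintype σ] [Fintype κ] [Fintype ν] [DecidableEq σ]
    [DecidableEq κ] [DecidableEq ν] {y : Matrix σ κ (ZMod 2)}
    (hy : LinearIndependent (ZMod 2) y.row) (Z : Matrix σ ν (ZMod 2)) :
    unifProb {G : Matrix κ ν (ZMod 2) | y * G = Z} ≤
      ((2 : ℝ) ^ (Fintype.card σ * Fintype.card ν))⁻¹ := by
  classical
  obtain ⟨N, hN⟩ : ∃ N : Matrix κ σ (ZMod 2), y * N = 1 := by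
    refine Matrix.mulVec_surjective_iff_exists_right_inverse.1 
      (LinearMap.range_eq_top (f := y.mulVecLin).1 ?_)
    refine Submodule.eq_top_of_finrank_eq (S := LinearMap.range y.mulVecLin) ?_
    rw [Module.finrank_fintype_fun_eq_card]
    exact hy.rank_matrix
  have hinj : Fintype.card (Matrix σ ν (ZMod 2)) * {G : Matrix κ ν (ZMod 2) | y * G = Z}.ncard ≤
      Fintype.card (Matrix κ ν (ZMod 2)) := by
    rw [← Nat.card_coe_set_eq, ← Nat.card_eq_fintype_card, ← Nat.card_eq_fintype_card,
      ← Nat.card_prod]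
    refine Nat.card_le_card_of_injective
      (fun q : Matrix σ ν (ZMod 2) × {G : Matrix κ ν (ZMod 2) | y * G = Z} => q.2.1 + N * q.1) ?_
    rintro ⟨a, G, hG⟩ ⟨a', G', hG'⟩ h
    simp only [Set.mem_ofPred_eq] at hG hG' h
    have h2 := congrArg (y * ·) h
    simp only [Matrix.mul_add, hG, hG', ← Matrix.mul_assoc, hN, Matrix.one_mul,
      add_right_inj] at h2
    subst h2
    simp only [add_left_inj] at h
    subst h
    rfl
  have hc : (Fintype.card (Matrix σ ν (ZMod 2)) : ℝ) = 2 ^ (Fintype.card σ * Fintype.card ν) := by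
    rw [card_matrix_zmod_two]
    push_cast
    rfl
  rw [unifProb, div_le_iff₀ (by positivity), inv_mul_eq_div, le_div_iff₀ (by positivity), ← hc,
    mul_comm]
  exact_mod_cast hinj

theorem unifProb_mul_transpose_eq_le {σ κ ν : Type*} [Fintype σ] [Fintype κ] [Fintype ν]
    [DecidableEq σ] [DecidableEq κ] [DecidableEq ν] {y : Matrix σ κ (ZMod 2)}
    (hy : LinearIndependent (ZMod 2) y.row) (Z : Matrix σ ν (ZMod 2)) :
    unifProb {H : Matrix ν κ (ZMod 2) | y * Hᵀ = Z} ≤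
      ((2 : ℝ) ^ (Fintype.card σ * Fintype.card ν))⁻¹ := by
  refine le_of_eq_of_le ?_ (unifProb_mul_eq_le hy Z)
  exact unifProb_preimage_equiv
    (⟨transpose, transpose, transpose_transpose, transpose_transpose⟩ :
      Matrix ν κ (ZMod 2) ≃ Matrix κ ν (ZMod 2)) {G | y * G = Z}

theorem ncard_matrix_le {σ κ : Type*} [Fintype σ] [Fintype κ] [DecidableEq σ] [DecidableEq κ]
    (Q : Matrix σ κ (ZMod 2) → Prop) :
    ({y | Q y}.ncard : ℝ) ≤ (2 : ℝ) ^ (Fintype.card σ * Fintype.card κ) := by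
  have h := Set.ncard_le_card {y | Q y}
  rw [Nat.card_eq_fintype_card, card_matrix_zmod_two] at h
  exact_mod_cast h

theorem exists_rows_mem_of_le_finrank {K α : Type*} [Field K] [Fintype α] {τ : ℕ}
    (S : Submodule K (α → K)) (h : τ ≤ Module.finrank K S) :
    ∃ y : Matrix (Fin τ) α K, LinearIndependent K y.row ∧ ∀ i, y i ∈ S := by
  obtain ⟨f, hf⟩ := exists_linearIndependent_of_le_finrank h
  exact ⟨Matrix.of fun i => (f i : α → K),
    hf.map' S.subtype (LinearMap.ker_eq_bot.2 S.injective_subtype), fun i => (f i).2⟩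

theorem linearIndependent_row_mul {K α β γ : Type*} [Field K] [Fintype α] [Fintype β]
    {y : Matrix α β K} {M : Matrix β γ K} (hy : LinearIndependent K y.row)
    (hM : LinearIndependent K M.row) : LinearIndependent K (y * M).row := by
  rw [← Matrix.vecMul_injective_iff] at *
  intro a b hab
  refine hy (hM ?_)
  simpa only [Matrix.vecMul_vecMul] using hab

theorem linearIndependent_row_of_mul {K α β γ : Type*} [Field K] [Fintype α] [Fintype β]
    {y : Matrix α β K} {M : Matrix β γ K} (hy : LinearIndependent K (y * M).row) :
    LinearIndependent K y.row := by
  rw [← Matrix.vecMul_injective_iff] at *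
  intro a b hab
  refine hy ?_
  simp only [← Matrix.vecMul_vecMul]
  exact congrArg (· ᵥ* M) hab

theorem le_rank_of_forall_mul_ne_zero {K γ : Type*} [Field K] [Fintype γ] {τ : ℕ}
    (hτ : 0 < τ) {A : Matrix (Fin (2 * τ - 1)) γ K}
    (h : ∀ y : Matrix (Fin τ) (Fin (2 * τ - 1)) K, LinearIndependent K y.row → y * A ≠ 0) :
    τ ≤ A.rank := by
  by_contra! hlt
  have h1 := LinearMap.finrank_range_add_finrank_ker Aᵀ.mulVecLin
  rw [Module.finrank_fintype_fun_eq_card, Fintype.card_fin] at h1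
  have h2 : Module.finrank K (LinearMap.range Aᵀ.mulVecLin) = A.rank := Matrix.rank_transpose A
  obtain ⟨y, hy, hmem⟩ := exists_rows_mem_of_le_finrank (τ := τ) (LinearMap.ker Aᵀ.mulVecLin)
    (by omega)
  refine h y hy ?_
  ext i j
  have h3 : Aᵀ *ᵥ y i = 0 := hmem i
  rw [Matrix.mulVec_transpose] at h3
  exact congrFun h3 j

/-- Multiplying a word of the dual tensor code by a parity check matrix of the row code gives a
matrix with column space contained in the column code. -/
theorem IsDualTensor.mulVec_mem {A B : Type*} [Fintype B] {m : ℕ}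
    {CA : Submodule (ZMod 2) (A → ZMod 2)}
    {H : Matrix (Fin m) B (ZMod 2)} {X : Matrix A B (ZMod 2)}
    (hX : IsDualTensor CA (LinearMap.ker H.mulVecLin) X) (v : Fin m → ZMod 2) :
    (X * Hᵀ) *ᵥ v ∈ CA := by
  obtain ⟨C, R, hC, hR, rfl⟩ := hX
  have h1 : R * Hᵀ = 0 := by
    ext a j
    have h2 : H *ᵥ R.row a = 0 := hR a
    have h3 := congrFun h2 j
    simpa [Matrix.mul_apply, mulVec, dotProduct, mul_comm] using h3
  rw [Matrix.add_mul, h1, add_zero, ← mulVec_mulVec, mulVec_eq_sum]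
  refine CA.sum_mem fun b _ => ?_
  rw [op_smul_eq_smul]
  exact CA.smul_mem _ (hC b)

section FixedBound

variable {n k m r τ : ℕ} {W : Matrix (Fin n) (Fin r) (ZMod 2)} {I : Fin r → Fin n}
  {M : Matrix (Fin r) (Fin n) (ZMod 2)}

theorem unifProb_exists_mul_transpose_eq_zero_le {ℓ : ℕ} {N : Matrix (Fin ℓ) (Fin n) (ZMod 2)}
    (hN : LinearIndependent (ZMod 2) N.row) :
    unifProb {H : Matrix (Fin m) (Fin n) (ZMod 2) |
      ∃ y : Matrix (Fin τ) (Fin ℓ) (ZMod 2), LinearIndependent (ZMod 2) y.row ∧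
        y * (N * Hᵀ) = 0} ≤ 2 ^ (τ * ℓ) * ((2 : ℝ) ^ (τ * m))⁻¹ := by
  refine (unifProb_exists_le _ _ (b := ((2 : ℝ) ^ (τ * m))⁻¹) fun y hy => ?_).trans ?_
  · simp_rw [← Matrix.mul_assoc]
    simpa using unifProb_mul_transpose_eq_le (ν := Fin m) (linearIndependent_row_mul hy hN) 0
  · gcongr
    simpa using ncard_matrix_le fun y : Matrix (Fin τ) (Fin ℓ) (ZMod 2) =>
      LinearIndependent (ZMod 2) y.row

theorem unifProb_exists_mul_eq_le {Z : Matrix (Fin τ) (Fin n) (ZMod 2)} :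
    unifProb {G : Matrix (Fin k) (Fin n) (ZMod 2) |
      ∃ x : Matrix (Fin τ) (Fin k) (ZMod 2), LinearIndependent (ZMod 2) x.row ∧ x * G = Z} ≤
        2 ^ (τ * k) * ((2 : ℝ) ^ (τ * n))⁻¹ := by
  refine (unifProb_exists_le _ _ (b := ((2 : ℝ) ^ (τ * n))⁻¹) fun x hx => ?_).trans ?_
  · simpa using unifProb_mul_eq_le hx Z
  · gcongr
    simpa using ncard_matrix_le fun x : Matrix (Fin τ) (Fin k) (ZMod 2) =>
      LinearIndependent (ZMod 2) x.row

theorem exists_rows_mem_range_mulVecLin (hτ : 0 < τ) (hr : 2 * τ - 1 ≤ r)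
    (hW : IsUnit (W.submatrix I id)) {H : Matrix (Fin m) (Fin n) (ZMod 2)}
    (hH : ¬ ∃ y : Matrix (Fin τ) (Fin (2 * τ - 1)) (ZMod 2), LinearIndependent (ZMod 2) y.row ∧
        y * (M.submatrix (Fin.castLE hr) id * Hᵀ) = 0) :
    ∃ Z : Matrix (Fin τ) (Fin n) (ZMod 2), LinearIndependent (ZMod 2) Z.row ∧
      ∀ i, Z i ∈ LinearMap.range (W * M * Hᵀ).mulVecLin := by
  refine exists_rows_mem_of_le_finrank _ ?_
  change τ ≤ (W * M * Hᵀ).rank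
  push Not at hH
  have h1 := le_rank_of_forall_mul_ne_zero hτ hH
  have h2 : (M.submatrix (Fin.castLE hr) id * Hᵀ).rank ≤ (M * Hᵀ).rank :=
    Matrix.rank_submatrix_le (M * Hᵀ) (Fin.castLE hr) id
  have h3 : (W.submatrix I id * (M * Hᵀ)).rank ≤ (W * M * Hᵀ).rank := by
    rw [Matrix.mul_assoc]
    exact Matrix.rank_submatrix_le (W * (M * Hᵀ)) I id
  rw [Matrix.rank_mul_eq_right_of_isUnit_det _ _ ((Matrix.isUnit_iff_isUnit_det _).1 hW)] at h3
  omega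

/-- The probability that a fixed matrix of rank `r` lies in the random dual tensor code. -/
theorem unifProb_isDualTensor_le (hτ : 0 < τ) (hr : 2 * τ - 1 ≤ r)
    (hW : IsUnit (W.submatrix I id)) (hM : LinearIndependent (ZMod 2) M.row) :
    unifProb {MN : Matrix (Fin k) (Fin n) (ZMod 2) × Matrix (Fin m) (Fin n) (ZMod 2) |
      IsDualTensor (LinearMap.range MN.1.vecMulLinear) (LinearMap.ker MN.2.mulVecLin) (W * M)} ≤
      2 ^ (τ * (2 * τ - 1)) * ((2 : ℝ) ^ (τ * m))⁻¹ + 2 ^ (τ * k) * ((2 : ℝ) ^ (τ * n))⁻¹ := by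
  classical
  set N := M.submatrix (Fin.castLE hr) id with hN
  have hNli : LinearIndependent (ZMod 2) N.row := hM.comp _ (Fin.castLE_injective hr)
  set E := {H : Matrix (Fin m) (Fin n) (ZMod 2) |
      ∃ y : Matrix (Fin τ) (Fin (2 * τ - 1)) (ZMod 2), LinearIndependent (ZMod 2) y.row ∧
        y * (N * Hᵀ) = 0} with hE
  have hE1 := unifProb_exists_mul_transpose_eq_zero_le (m := m) (τ := τ) hNli
  refine (unifProb_mono (T := {MN | MN.2 ∈ E} ∪ {MN | MN.2 ∉ E ∧
    IsDualTensor (LinearMap.range MN.1.vecMulLinear) (LinearMap.ker MN.2.mulVecLin) (W * M)})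
    fun MN h => ?_).trans ((unifProb_union_le _ _).trans (add_le_add ?_ ?_))
  · by_cases h2 : MN.2 ∈ E
    · exact Or.inl h2
    · exact Or.inr ⟨h2, h⟩
  · rw [← unifProb_preimage_equiv (Equiv.prodComm _ _)]
    exact unifProb_prod_le fun _ => hE1
  · refine unifProb_prod_le fun H => ?_
    by_cases hH : H ∈ E
    · refine le_trans (unifProb_mono (T := ∅) fun G hG => hG.1 hH) ?_
      simp only [unifProb, Set.ncard_empty, Nat.cast_zero, zero_div]
      positivity
    · obtain ⟨Z, hZ, hmem⟩ := exists_rows_mem_range_mulVecLin (M := M) hτ hr hW hH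
      refine (unifProb_mono fun G hG => ?_).trans (unifProb_exists_mul_eq_le (Z := Z))
      have h1 : ∀ i, ∃ x : Fin k → ZMod 2, x ᵥ* G = Z i := by
        intro i
        obtain ⟨v, hv⟩ := hmem i
        have h2 := hG.2.mulVec_mem v
        rw [← Matrix.mulVecLin_apply, hv] at h2
        exact h2
      choose x hx using h1
      have h3 : Matrix.of x * G = Z := by
        ext i j
        exact congrFun (hx i) j
      exact ⟨Matrix.of x, linearIndependent_row_of_mul (M := G) (by rwa [h3]), h3⟩

end FixedBound

theorem two_pow_mul_inv_le {a b : ℕ} {x : ℝ} (h : a + x ≤ b) :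
    (2 : ℝ) ^ a * ((2 : ℝ) ^ b)⁻¹ ≤ 2 ^ (-x) := by
  rw [← Real.rpow_natCast, ← Real.rpow_natCast, ← Real.rpow_neg (by norm_num),
    ← Real.rpow_add (by norm_num)]
  exact Real.rpow_le_rpow_of_exponent_le (by norm_num) (by linarith)

theorem exists_rank_threshold {n k m r : ℕ} {κ : ℝ} (hκ0 : 0 < κ) (hκ1 : κ ≤ 1)
    (hn : 1 ≤ κ * n) (hk : k ≤ (1 - κ) * n) (hm : 4 * κ * n - 1 ≤ m) (hr : 0 < r) (hrn : r ≤ n) :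
    ∃ τ : ℕ, 0 < τ ∧ 2 * τ - 1 ≤ r ∧
      2 ^ (τ * (2 * τ - 1)) * ((2 : ℝ) ^ (τ * m))⁻¹ + 2 ^ (τ * k) * ((2 : ℝ) ^ (τ * n))⁻¹ ≤
        2 * ((2 : ℝ) ^ (-(κ ^ 2 / 4 * n))) ^ r := by
  have hr' : (0 : ℝ) < r := Nat.cast_pos.2 hr
  have hrn' : (r : ℝ) ≤ n := Nat.cast_le.2 hrn
  set τ := ⌈κ / 4 * r⌉₊ with hτ
  have h0 : 0 < τ := Nat.ceil_pos.2 (by positivity)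
  have h1 : κ / 4 * r ≤ τ := Nat.le_ceil _
  have h2 : (τ : ℝ) < κ / 4 * r + 1 := Nat.ceil_lt_add_one (by positivity)
  have h3 : κ * r ≤ r := by nlinarith
  have h4 : κ * r ≤ κ * n := by gcongr
  have hℓ : ((2 * τ - 1 : ℕ) : ℝ) = 2 * τ - 1 := by
    rw [Nat.cast_sub (by omega)]
    push_cast
    ring
  have h0' : (0 : ℝ) ≤ τ := Nat.cast_nonneg _
  have hx : κ ^ 2 / 4 * n * r ≤ τ * (κ * n) := by
    calc κ ^ 2 / 4 * n * r = κ / 4 * r * (κ * n) := by ring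
      _ ≤ τ * (κ * n) := by gcongr
  refine ⟨τ, h0, ?_, ?_⟩
  · by_contra! hlt
    have h5 : (r : ℝ) + 1 ≤ ((2 * τ - 1 : ℕ) : ℝ) := by exact_mod_cast hlt
    rw [hℓ] at h5
    linarith
  · rw [← Real.rpow_mul_natCast (by norm_num), neg_mul, two_mul (_ ^ _)]
    refine add_le_add (two_pow_mul_inv_le ?_) (two_pow_mul_inv_le ?_)
    · rw [Nat.cast_mul, Nat.cast_mul, hℓ]
      have : (2 * τ - 1 : ℝ) + κ * n ≤ m := by linarith
      nlinarith
    · rw [Nat.cast_mul, Nat.cast_mul]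
      have : (k : ℝ) + κ * n ≤ n := by linarith
      nlinarith

theorem ncard_light_triples_le {n r : ℕ} {t : ℝ}
    (P : Matrix (Fin r) (Fin n) (ZMod 2) × Matrix (Fin r) (Fin n) (ZMod 2) × (Fin r → Fin n) →
      Prop) :
    {i | ((∀ j, (wt (i.1 j) : ℝ) ≤ t) ∧ ∀ j, (wt (i.2.1 j) : ℝ) ≤ t) ∧ P i}.ncard ≤
      ({x : Fin n → ZMod 2 | (wt x : ℝ) ≤ t}.ncard ^ 2 * n) ^ r := by
  have h1 : Nat.card ((Fin r → {x : Fin n → ZMod 2 | (wt x : ℝ) ≤ t}) ×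
      (Fin r → {x : Fin n → ZMod 2 | (wt x : ℝ) ≤ t}) × (Fin r → Fin n)) =
      ({x : Fin n → ZMod 2 | (wt x : ℝ) ≤ t}.ncard ^ 2 * n) ^ r := by
    rw [Nat.card_prod, Nat.card_prod, Nat.card_fun, Nat.card_fun, Nat.card_coe_set_eq,
      Nat.card_fin, Nat.card_fin]
    ring
  rw [← h1, ← Nat.card_coe_set_eq]
  refine Nat.card_le_card_of_injective
    (fun i => (fun j => ⟨i.1.1 j, i.2.1.1 j⟩, fun j => ⟨i.1.2.1 j, i.2.1.2 j⟩, i.1.2.2)) ?_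
  rintro ⟨⟨U, V, I⟩, hi⟩ ⟨⟨U', V', I'⟩, hi'⟩ h
  simp only [Prod.mk.injEq, funext_iff, Subtype.mk.injEq] at h
  have hU : U = U' := funext fun j => funext fun a => h.1 j a
  have hV : V = V' := funext fun j => funext fun a => h.2.1 j a
  have hI : I = I' := funext h.2.2
  subst hU hV hI
  rfl

theorem unifProb_exists_light_triple_le {n k m r : ℕ} {κ t q : ℝ} (hκ0 : 0 < κ) (hκ1 : κ ≤ 1)
    (hn : 1 ≤ κ * n) (hk : k ≤ (1 - κ) * n) (hm : 4 * κ * n - 1 ≤ m)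
    (hq : ({x : Fin n → ZMod 2 | (wt x : ℝ) ≤ t}.ncard : ℝ) ^ 2 * n * 2 ^ (-(κ ^ 2 / 4 * n)) ≤ q)
    (hq1 : q ≤ 1) (hr : 0 < r) (hrn : r ≤ n) :
    unifProb {MN : Matrix (Fin k) (Fin n) (ZMod 2) × Matrix (Fin m) (Fin n) (ZMod 2) |
      ∃ i : Matrix (Fin r) (Fin n) (ZMod 2) × Matrix (Fin r) (Fin n) (ZMod 2) × (Fin r → Fin n),
      (((∀ j, (wt (i.1 j) : ℝ) ≤ t) ∧ ∀ j, (wt (i.2.1 j) : ℝ) ≤ t) ∧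
        IsUnit (i.1ᵀ.submatrix i.2.2 id) ∧ LinearIndependent (ZMod 2) i.2.1.row) ∧
      IsDualTensor (LinearMap.range MN.1.vecMulLinear) (LinearMap.ker MN.2.mulVecLin)
        (i.1ᵀ * (i.1ᵀ.submatrix i.2.2 id)⁻¹ * i.2.1)} ≤ 2 * q := by
  have hq0 : 0 ≤ q := le_trans (by positivity) hq
  obtain ⟨τ, hτ0, hτr, hτ⟩ := exists_rank_threshold hκ0 hκ1 hn hk hm hr hrn
  refine (unifProb_exists_le _ _ (b := 2 * ((2 : ℝ) ^ (-(κ ^ 2 / 4 * n))) ^ r)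
    fun i hi => ?_).trans ?_
  · refine le_trans ?_ hτ
    simp only [Matrix.mul_assoc]
    refine unifProb_isDualTensor_le (I := i.2.2) hτ0 hτr hi.2.1 ?_
    refine linearIndependent_row_mul ?_ hi.2.2
    exact Matrix.linearIndependent_rows_of_isUnit (Matrix.isUnit_nonsing_inv_iff.2 hi.2.1)
  · have h1 := (Nat.cast_le (α := ℝ)).2 (ncard_light_triples_le (n := n) (r := r) (t := t)
      fun i => IsUnit (i.1ᵀ.submatrix i.2.2 id) ∧ LinearIndependent (ZMod 2) i.2.1.row)
    refine (mul_le_mul_of_nonneg_right h1 (by positivity)).trans ?_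
    rw [Nat.cast_pow, Nat.cast_mul, Nat.cast_pow]
    generalize (({x : Fin n → ZMod 2 | (wt x : ℝ) ≤ t}.ncard : ℕ) : ℝ) = L at hq
    calc (L ^ 2 * n) ^ r * (2 * ((2 : ℝ) ^ (-(κ ^ 2 / 4 * n))) ^ r)
      _ = 2 * (L ^ 2 * n * 2 ^ (-(κ ^ 2 / 4 * n))) ^ r := by
          rw [mul_pow _ ((2 : ℝ) ^ (-(κ ^ 2 / 4 * n)))]
          ring
      _ ≤ 2 * q ^ r := by gcongr
      _ ≤ 2 * q := by
          gcongr
          exact pow_le_of_le_one hq0 hq1 (by omega)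

theorem unifProb_not_noLightSkeleton_le {n k m : ℕ} {κ t q : ℝ} (hκ0 : 0 < κ) (hκ1 : κ ≤ 1)
    (hn : 1 ≤ κ * n) (hk : k ≤ (1 - κ) * n) (hm : 4 * κ * n - 1 ≤ m)
    (hq : ({x : Fin n → ZMod 2 | (wt x : ℝ) ≤ t}.ncard : ℝ) ^ 2 * n * 2 ^ (-(κ ^ 2 / 4 * n)) ≤ q)
    (hq1 : q ≤ 1) :
    unifProb {MN : Matrix (Fin k) (Fin n) (ZMod 2) × Matrix (Fin m) (Fin n) (ZMod 2) |
      ¬ NoLightSkeleton (LinearMap.range MN.1.vecMulLinear) (LinearMap.ker MN.2.mulVecLin) t} ≤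
      n * (2 * q) := by
  have h1 : ∑ r ∈ Finset.Icc 1 n, 2 * q = n * (2 * q) := by
    rw [Finset.sum_const, Nat.card_Icc, nsmul_eq_mul, Nat.add_sub_cancel]
  rw [← h1]
  refine (unifProb_mono ?_).trans ((unifProb_biUnion_le _ _).trans (Finset.sum_le_sum fun r hr =>
    unifProb_exists_light_triple_le hκ0 hκ1 hn hk hm hq hq1 (Finset.mem_Icc.1 hr).1
      (Finset.mem_Icc.1 hr).2))
  intro MN h
  simp only [Set.mem_ofPred_eq, NoLightSkeleton, not_forall, not_not] at h
  obtain ⟨r, U, V, I, hr, hU, hV, hUI, hli, h⟩ := h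
  have hrn : r ≤ n := by simpa using hli.fintype_card_le_finrank
  simp only [Set.mem_iUnion]
  exact ⟨r, Finset.mem_Icc.2 ⟨hr, hrn⟩, (U, V, I), ⟨⟨hU, hV⟩, hUI, hli⟩, h⟩

theorem sum_pow_wt (n : ℕ) (z : ℝ) : ∑ x : Fin n → ZMod 2, z ^ wt x = (1 + z) ^ n := by
  have h1 : (1 + z) = ∑ a : ZMod 2, if a ≠ 0 then z else 1 := by
    change 1 + z = ∑ a : Fin 2, if a ≠ 0 then z else 1
    simp [Fin.sum_univ_two]
  rw [h1, Fintype.sum_pow]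
  refine Finset.sum_congr rfl fun x _ => ?_
  rw [wt_eq_sum, ← Finset.prod_pow_eq_pow_sum]
  refine Finset.prod_congr rfl fun i _ => ?_
  split_ifs <;> simp

theorem ncard_wt_le_mul_rpow_le (n : ℕ) {t z : ℝ} (hz0 : 0 < z) (hz1 : z ≤ 1) :
    ({x : Fin n → ZMod 2 | (wt x : ℝ) ≤ t}.ncard : ℝ) * z ^ t ≤ (1 + z) ^ n := by
  classical
  rw [← sum_pow_wt, ncard_eq_sum, Nat.cast_sum, Finset.sum_mul]
  refine Finset.sum_le_sum fun x _ => ?_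
  split_ifs with h
  · rw [Nat.cast_one, one_mul, ← Real.rpow_natCast]
    exact Real.rpow_le_rpow_of_exponent_ge hz0 hz1 h
  · rw [Nat.cast_zero, zero_mul]
    positivity

/-- The number of words of small linear weight is exponential with a small exponent. -/
theorem exists_ncard_wt_le_le {δ : ℝ} (hδ : 0 < δ) : ∃ β : ℝ, 0 < β ∧ β < 1 ∧ ∀ n : ℕ,
    ({x : Fin n → ZMod 2 | (wt x : ℝ) ≤ β * n}.ncard : ℝ) ≤ 2 ^ (δ * n) := by
  have h1 : Filter.Tendsto (fun a : ℝ => 1 + (2 : ℝ) ^ (-a)) Filter.atTop (nhds (1 + 0)) := by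
    refine Filter.Tendsto.const_add _ ?_
    exact (tendsto_rpow_atBot_of_base_gt_one 2 (by norm_num)).comp Filter.tendsto_neg_atTop_atBot
  have h2 : 1 + 0 < (2 : ℝ) ^ (δ / 2) := by
    rw [add_zero]
    exact Real.one_lt_rpow (by norm_num) (by positivity)
  obtain ⟨a, ha, had⟩ := ((h1.eventually_le_const h2).and (Filter.eventually_ge_atTop δ)).exists
  have ha0 : 0 < a := hδ.trans_le had
  refine ⟨δ / (2 * a), by positivity, ?_, fun n => ?_⟩
  · rw [div_lt_one (by positivity)]
    linarith
  · have h3 := ncard_wt_le_mul_rpow_le n (t := δ / (2 * a) * n) (z := 2 ^ (-a)) (by positivity)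
      (Real.rpow_le_one_of_one_le_of_nonpos (by norm_num) (by linarith))
    have h4 : (1 + (2 : ℝ) ^ (-a)) ^ n ≤ 2 ^ (δ / 2 * n) := by
      rw [Real.rpow_mul_natCast (by norm_num)]
      gcongr
    have h5 : ((2 : ℝ) ^ (-a)) ^ (δ / (2 * a) * n) = (2 ^ (δ / 2 * n))⁻¹ := by
      rw [← Real.rpow_mul (by norm_num), ← Real.rpow_neg (by norm_num)]
      congr 1
      field_simp
    have h6 : (2 : ℝ) ^ (δ * n) = 2 ^ (δ / 2 * n) * 2 ^ (δ / 2 * n) := by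
      rw [← Real.rpow_add (by norm_num)]
      congr 1
      ring
    rw [h5] at h3
    rw [h6, ← div_le_iff₀ (by positivity), div_eq_mul_inv]
    exact h3.trans h4

theorem tendsto_pow_mul_two_rpow_neg {c : ℝ} (hc : 0 < c) (k : ℕ) :
    Filter.Tendsto (fun n : ℕ => (n : ℝ) ^ k * 2 ^ (-(c * n))) Filter.atTop (nhds 0) := by
  have h := tendsto_pow_const_mul_const_pow_of_abs_lt_one k (r := 2 ^ (-c)) (by
    rw [abs_of_pos (by positivity)]
    exact Real.rpow_lt_one_of_one_lt_of_neg (by norm_num) (by linarith))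
  refine h.congr fun n => ?_
  rw [← neg_mul, Real.rpow_mul_natCast (by norm_num)]

theorem eventually_rpow_le_mul {a b c : ℝ} (hab : a < b) (hc : 0 < c) :
    ∀ᶠ n : ℕ in Filter.atTop, (n : ℝ) ^ a ≤ c * (n : ℝ) ^ b := by
  have h := ((tendsto_rpow_neg_atTop (sub_pos.2 hab)).comp
    tendsto_natCast_atTop_atTop).eventually_le_const hc
  filter_upwards [h, Filter.eventually_gt_atTop 0] with n hn hn0
  have hn0' : (0 : ℝ) < n := Nat.cast_pos.2 hn0
  calc (n : ℝ) ^ a = (n : ℝ) ^ (-(b - a)) * (n : ℝ) ^ b := by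
        rw [← Real.rpow_add hn0']
        congr 1
        ring
    _ ≤ c * (n : ℝ) ^ b := by
        gcongr
        exact hn

theorem tendsto_unifProb_not_noLightSkeleton {ρA ρB : ℝ} (hρA0 : 0 < ρA) (hρA1 : ρA < 1)
    (hρB1 : ρB < 1) : ∃ β : ℝ, 0 < β ∧ β < 1 ∧
      Filter.Tendsto (fun n : ℕ => unifProb {MN :
          Matrix (Fin ⌊ρA * n⌋₊) (Fin n) (ZMod 2) ×
            Matrix (Fin ⌊(1 - ρB) * n⌋₊) (Fin n) (ZMod 2) |
          ¬ NoLightSkeleton (LinearMap.range MN.1.vecMulLinear) (LinearMap.ker MN.2.mulVecLin)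
            (β * n)}) Filter.atTop (nhds 0) := by
  obtain ⟨κ, hκ0, hκA, hκB⟩ : ∃ κ : ℝ, 0 < κ ∧ κ ≤ 1 - ρA ∧ 4 * κ ≤ 1 - ρB :=
    ⟨min (1 - ρA) ((1 - ρB) / 4), lt_min (by linarith) (by linarith), min_le_left _ _, by
      linarith [min_le_right (1 - ρA) ((1 - ρB) / 4)]⟩
  obtain ⟨β, hβ0, hβ1, hβ⟩ := exists_ncard_wt_le_le (δ := κ ^ 2 / 16) (by positivity)
  refine ⟨β, hβ0, hβ1, ?_⟩
  set q : ℕ → ℝ := fun n => n * 2 ^ (-(κ ^ 2 / 8 * n)) with hq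
  have hq0 : Filter.Tendsto q Filter.atTop (nhds 0) := by
    simpa using tendsto_pow_mul_two_rpow_neg (c := κ ^ 2 / 8) (by positivity) 1
  have hnq : Filter.Tendsto (fun n : ℕ => n * (2 * q n)) Filter.atTop (nhds 0) := by
    have h := (tendsto_pow_mul_two_rpow_neg (c := κ ^ 2 / 8) (by positivity) 2).const_mul 2
    rw [mul_zero] at h
    refine h.congr fun n => ?_
    rw [hq]
    ring
  refine tendsto_of_tendsto_of_tendsto_of_le_of_le' tendsto_const_nhds hnq
    (Filter.Eventually.of_forall fun n => unifProb_nonneg _) ?_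
  have hκn : ∀ᶠ n : ℕ in Filter.atTop, 1 ≤ κ * n :=
    (tendsto_natCast_atTop_atTop.const_mul_atTop hκ0).eventually_ge_atTop 1
  filter_upwards [hκn, hq0.eventually_le_const one_pos] with n hn hqn
  have hn0 : (0 : ℝ) ≤ n := Nat.cast_nonneg _
  refine unifProb_not_noLightSkeleton_le hκ0 (by linarith) hn ?_ ?_ ?_ hqn
  · refine (Nat.floor_le (by positivity)).trans ?_
    gcongr
    linarith
  · have h1 := Nat.lt_floor_add_one ((1 - ρB) * n)
    have h2 : 4 * κ * n ≤ (1 - ρB) * n := by gcongr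
    linarith
  · calc _ ≤ ((2 : ℝ) ^ (κ ^ 2 / 16 * n)) ^ 2 * n * 2 ^ (-(κ ^ 2 / 4 * n)) := by
          gcongr
          exact hβ n
      _ = n * (2 ^ (κ ^ 2 / 16 * n) * 2 ^ (κ ^ 2 / 16 * n) * 2 ^ (-(κ ^ 2 / 4 * n))) := by ring
      _ = q n := by
          rw [← Real.rpow_add (by norm_num), ← Real.rpow_add (by norm_num), hq]
          congr 2
          ring

theorem eventually_noLightSkeleton_imp_isRobustPunct {ε γ β : ℝ} (hε : 0 < ε + 1 / 2)
    (hγ : γ < 1) (hβ0 : 0 < β) (hβ1 : β < 1) : ∀ᶠ n : ℕ in Filter.atTop,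
      ∀ CA CB : Submodule (ZMod 2) (Fin n → ZMod 2), NoLightSkeleton CA CB (β * n) →
        IsRobustPunct CA CB ((n : ℝ) ^ ((3 : ℝ) / 2 - ε)) ((n : ℝ) ^ γ) := by
  have h1 : ∀ᶠ n : ℕ in Filter.atTop, 1 ≤ β / 2 * n :=
    (tendsto_natCast_atTop_atTop.const_mul_atTop (by positivity)).eventually_ge_atTop 1
  filter_upwards [h1, eventually_rpow_le_mul (a := 3 / 2 - ε) (b := 2) (c := β ^ 2 / 8)
    (by linarith) (by positivity), eventually_rpow_le_mul (c := β / 4) hγ (by positivity)]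
    with n hn hw hp CA CB h
  rw [Real.rpow_two] at hw
  rw [Real.rpow_one] at hp
  have hη : 0 < β / 2 * n := by linarith
  have hn0 : (0 : ℝ) < n := by
    by_contra! h0
    nlinarith
  have hs : (n : ℝ) ^ ((3 : ℝ) / 2 - ε) / (β / 2 * n) ≤ β / 4 * n := by
    rw [div_le_iff₀ hη]
    refine hw.trans_eq ?_
    ring
  refine h.isRobustPunct (η := β / 2 * n) (σ := β / 2 * n)
    (s := (n : ℝ) ^ ((3 : ℝ) / 2 - ε) / (β / 2 * n)) (by linarith) hn (by positivity)
    (div_mul_cancel₀ _ hη.ne').ge (by linarith) (by linarith) (by nlinarith)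

end

/-- Theorem 4: random dual tensor codes are
`Δ^{3/2-ε}`-robust with `Δ^γ`-resistance to puncturing with probability
tending to 1. -/
theorem random_dual_tensor_robust
    (ρA ρB ε γ : ℝ) (hρA0 : 0 < ρA) (hρA1 : ρA < 1) (hρB0 : 0 < ρB) (hρB1 : ρB < 1)
    (hε0 : 0 < ε) (hε1 : ε < 1/2) (hγ0 : 1/2 + ε < γ) (hγ1 : γ < 1) :
    Filter.Tendsto
      (fun Δ : ℕ =>
        unifProb {MN :
            Matrix (Fin ⌊ρA * Δ⌋₊) (Fin Δ) (ZMod 2) ×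
              Matrix (Fin ⌊(1 - ρB) * Δ⌋₊) (Fin Δ) (ZMod 2) |
          IsRobustPunct (LinearMap.range MN.1.vecMulLinear)
            (LinearMap.ker MN.2.mulVecLin)
            ((Δ : ℝ) ^ ((3 : ℝ)/2 - ε)) ((Δ : ℝ) ^ γ)})
      Filter.atTop (nhds 1) := by
  obtain ⟨β, hβ0, hβ1, hβ⟩ := tendsto_unifProb_not_noLightSkeleton hρA0 hρA1 hρB1
  have h1 := hβ.const_sub 1
  rw [sub_zero] at h1
  refine tendsto_of_tendsto_of_tendsto_of_le_of_le' h1 tendsto_const_nhds ?_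
    (Filter.Eventually.of_forall fun n => unifProb_le_one _)
  filter_upwards [eventually_noLightSkeleton_imp_isRobustPunct (ε := ε) (by linarith) hγ1
    hβ0 hβ1] with n hn
  refine le_trans ?_ (one_sub_unifProb_compl_le _)
  refine sub_le_sub_left (unifProb_mono ?_) 1
  exact fun MN hMN h => hMN (hn _ _ h)
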